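/- Selection property (attainment of the dual infimum under Slater's condition): assume (i) there exist λ₀ : P → [0,∞) and μ₀ ∈ [0,∞) such that sup_{x ∈ ℝ^d} [ p(T(x)) + Σ_{q∈P} λ₀(q)(v(q) − q(x)) − μ₀·r(x) ] is finite, and (ii) there exists x̄ ∈ ℝ^d with q(x̄) < v(q) for all q ∈ P and r(x̄) < 0. Then there exist λ* : P → [0,∞) and μ* ∈ [0,∞) such that R(v,p) = sup_{x ∈ ℝ^d} [ p(T(x)) + Σ_{q∈P} λ*(q)(v(q) − q(x)) − μ*·r(x) ]. -/

import Mathlib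

/-- The Lagrangian supremum with objective `f`, inequality constraints `g q ≥ 0` for `q ∈ P`
and the test `r ≤ 0`, at the multipliers `z = (lam, mu)`. -/
noncomputable def lagrangianSup {X ι : Type*} (P : Finset ι) (f : X → ℝ) (g : ι → X → ℝ)
    (r : X → ℝ) (z : (ι → ℝ) × ℝ) : EReal :=
  ⨆ x : X, ((f x + ∑ q ∈ P, z.1 q * g q x - z.2 * r x : ℝ) : EReal)

section

variable {X ι : Type*} {P : Finset ι} {f : X → ℝ} {g : ι → X → ℝ} {r : X → ℝ}

theorem lagrangianSup_congr {l l' : ι → ℝ} (h : ∀ q ∈ P, l q = l' q) (m : ℝ) :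
    lagrangianSup P f g r (l, m) = lagrangianSup P f g r (l', m) := by
  have hsum (x : X) : ∑ q ∈ P, l q * g q x = ∑ q ∈ P, l' q * g q x :=
    Finset.sum_congr rfl fun q hq => by rw [h q hq]
  simp only [lagrangianSup, hsum]

theorem lowerSemicontinuous_lagrangianSup :
    LowerSemicontinuous (lagrangianSup P f g r) :=
  lowerSemicontinuous_iSup fun x => Continuous.lowerSemicontinuous <|
    continuous_coe_real_ereal.comp (by fun_prop)

/-- A Slater point bounds all multipliers in a sublevel set of the Lagrangian supremum. -/
theorem multipliers_le_of_lagrangianSup_le {xb : X} (hg : ∀ q ∈ P, 0 < g q xb) (hr : r xb < 0)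
    {l : ι → ℝ} {m c : ℝ} (hl : ∀ q ∈ P, 0 ≤ l q) (hm : 0 ≤ m)
    (h : lagrangianSup P f g r (l, m) ≤ c) :
    (∀ q ∈ P, l q ≤ (c - f xb) / g q xb) ∧ m ≤ (c - f xb) / -r xb := by
  have hx : f xb + ∑ q ∈ P, l q * g q xb - m * r xb ≤ c :=
    EReal.coe_le_coe_iff.1 ((le_iSup (fun x => ((f x + ∑ q ∈ P, l q * g q x - m * r x : ℝ) :
      EReal)) xb).trans h)
  have hnonneg : ∀ q ∈ P, 0 ≤ l q * g q xb := fun q hq => mul_nonneg (hl q hq) (hg q hq).le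
  have hmr : 0 ≤ m * -r xb := mul_nonneg hm (by linarith)
  refine ⟨fun q hq => ?_, ?_⟩
  · rw [le_div_iff₀ (hg q hq)]
    linarith [Finset.single_le_sum hnonneg hq]
  · rw [le_div_iff₀ (by linarith)]
    linarith [Finset.sum_nonneg hnonneg]

/-- Under Slater's condition, the Lagrangian supremum attains its minimum over nonnegative
multipliers as soon as it is finite somewhere. -/
theorem exists_forall_lagrangianSup_le {xb : X} (hg : ∀ q ∈ P, 0 < g q xb) (hr : r xb < 0)
    {l₀ : ι → ℝ} {m₀ c : ℝ} (hl₀ : ∀ q ∈ P, 0 ≤ l₀ q) (hm₀ : 0 ≤ m₀)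
    (h₀ : lagrangianSup P f g r (l₀, m₀) ≤ c) :
    ∃ (ls : ι → ℝ) (ms : ℝ), (∀ q ∈ P, 0 ≤ ls q) ∧ 0 ≤ ms ∧
      ∀ (l : ι → ℝ) (m : ℝ), (∀ q ∈ P, 0 ≤ l q) → 0 ≤ m →
        lagrangianSup P f g r (ls, ms) ≤ lagrangianSup P f g r (l, m) := by
  classical
  let B : ι → ℝ := fun q => if q ∈ P then (c - f xb) / g q xb else 0
  let K : Set ((ι → ℝ) × ℝ) :=
    (Set.univ.pi fun q => Set.Icc 0 (B q)) ×ˢ Set.Icc 0 ((c - f xb) / -r xb)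
  have hK : IsCompact K := (isCompact_univ_pi fun _ => isCompact_Icc).prod isCompact_Icc
  have hmem (l : ι → ℝ) (m : ℝ) (hl : ∀ q ∈ P, 0 ≤ l q) (hm : 0 ≤ m)
      (h : lagrangianSup P f g r (l, m) ≤ c) :
      ((fun q => if q ∈ P then l q else 0), m) ∈ K := by
    obtain ⟨hlB, hmB⟩ := multipliers_le_of_lagrangianSup_le hg hr hl hm h
    refine ⟨fun q _ => ?_, hm, hmB⟩
    by_cases hq : q ∈ P
    · simpa [B, hq] using And.intro (hl q hq) (hlB q hq)
    · simp [B, hq]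
  have htrunc (l : ι → ℝ) (m : ℝ) :
      lagrangianSup P f g r ((fun q => if q ∈ P then l q else 0), m) =
        lagrangianSup P f g r (l, m) :=
    lagrangianSup_congr (fun q hq => if_pos hq) m
  obtain ⟨⟨ls, ms⟩, hs, hmin⟩ :=
    (lowerSemicontinuous_lagrangianSup (P := P) (f := f) (g := g) (r := r)
      |>.lowerSemicontinuousOn K).exists_isMinOn ⟨_, hmem l₀ m₀ hl₀ hm₀ h₀⟩ hK
  have hle (l : ι → ℝ) (m : ℝ) (hl : ∀ q ∈ P, 0 ≤ l q) (hm : 0 ≤ m)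
      (h : lagrangianSup P f g r (l, m) ≤ c) :
      lagrangianSup P f g r (ls, ms) ≤ lagrangianSup P f g r (l, m) :=
    (hmin (hmem l m hl hm h)).trans_eq (htrunc l m)
  refine ⟨ls, ms, fun q _ => (hs.1 q trivial).1, hs.2.1, fun l m hl hm => ?_⟩
  rcases le_total (lagrangianSup P f g r (l, m)) c with h | h
  · exact hle l m hl hm h
  · exact ((hle l₀ m₀ hl₀ hm₀ h₀).trans h₀).trans h

end


/-- Selection property: if some pair of multipliers gives a finite Lagrangian
supremum and Slater's condition holds, then the dual infimum defining the
relaxed value `R(v,p)` is attained by some multipliers `(λ*, μ*)`. -/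
theorem relaxed_value_dual_attained (d : ℕ) (hd : 1 ≤ d)
    (P : Finset ((Fin d → ℝ) → ℝ)) (T : (Fin d → ℝ) → Fin d → ℝ)
    (r p : (Fin d → ℝ) → ℝ) (v : ((Fin d → ℝ) → ℝ) → ℝ)
    (hfin : ∃ (lam₀ : ((Fin d → ℝ) → ℝ) → ℝ) (mu₀ : ℝ),
      (∀ q ∈ P, 0 ≤ lam₀ q) ∧ 0 ≤ mu₀ ∧
      ∃ c : ℝ,
        (⨆ x : Fin d → ℝ,
          ((p (T x) + ∑ q ∈ P, lam₀ q * (v q - q x) - mu₀ * r x : ℝ) : EReal))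
          = (c : EReal))
    (hslater : ∃ xb : Fin d → ℝ, (∀ q ∈ P, q xb < v q) ∧ r xb < 0) :
    ∃ (lams : ((Fin d → ℝ) → ℝ) → ℝ) (mus : ℝ),
      (∀ q ∈ P, 0 ≤ lams q) ∧ 0 ≤ mus ∧
      (⨅ lam ∈ {l : ((Fin d → ℝ) → ℝ) → ℝ | ∀ q ∈ P, 0 ≤ l q},
        ⨅ mu ∈ {m : ℝ | 0 ≤ m},
          ⨆ x : Fin d → ℝ,
            ((p (T x) + ∑ q ∈ P, lam q * (v q - q x) - mu * r x : ℝ) : EReal)) =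
        ⨆ x : Fin d → ℝ,
          ((p (T x) + ∑ q ∈ P, lams q * (v q - q x) - mus * r x : ℝ) : EReal) := by
  obtain ⟨lam₀, mu₀, hl₀, hm₀, c, hc⟩ := hfin
  obtain ⟨xb, hq, hr⟩ := hslater
  obtain ⟨ls, ms, hls, hms, hmin⟩ := exists_forall_lagrangianSup_le (P := P)
    (f := fun x => p (T x)) (g := fun q x => v q - q x) (r := r)
    (fun q h => sub_pos.2 (hq q h)) hr hl₀ hm₀ hc.le
  exact ⟨ls, ms, hls, hms, le_antisymm (iInf₂_le_of_le ls hls (iInf₂_le ms hms))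
    (le_iInf₂ fun l hl => le_iInf₂ fun m hm => hmin l m hl hm)⟩
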